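/- There exists a constant c > 0 such that for all integers n ≥ 4 and s with 1 ≤ s ≤ log₂ log₂ n + 2, λ(s,n) ≥ c · n · 2^s. -/

import Mathlib

/-- The alternating sequence `a, b, a, b, ...` of length `k`. -/
def altSeq {α : Type*} (a b : α) : ℕ → List α
  | 0 => []
  | k + 1 => a :: altSeq b a k

/-- `l` avoids alternations of length `k`: it has no (not necessarily contiguous)
subsequence `a, b, a, b, ...` of length `k` with `a ≠ b`. -/
def AvoidsAlt {α : Type*} (l : List α) (k : ℕ) : Prop :=
  ∀ a b : α, a ≠ b → ¬ (altSeq a b k).Sublist l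

/-- `l` is an order-`s` Davenport–Schinzel sequence over an alphabet of `n` symbols:
no two consecutive entries are equal and it avoids alternations of length `s + 2`. -/
def IsDS (s n : ℕ) (l : List (Fin n)) : Prop :=
  l.Chain' (· ≠ ·) ∧ AvoidsAlt l (s + 2)

/-- `lambdaDS s n` is the maximum length of an order-`s` Davenport–Schinzel
sequence over an alphabet of `n` symbols. -/
noncomputable def lambdaDS (s n : ℕ) : ℕ :=
  sSup { L | ∃ l : List (Fin n), IsDS s n l ∧ l.length = L }

section Alternations

variable {α β : Type*}

@[simp] theorem length_altSeq (a b : α) (k : ℕ) : (altSeq a b k).length = k := by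
  induction k generalizing a b with
  | zero => rfl
  | succ k ih => simp [altSeq, ih]

theorem map_altSeq (f : α → β) (a b : α) (k : ℕ) :
    (altSeq a b k).map f = altSeq (f a) (f b) k := by
  induction k generalizing a b with
  | zero => rfl
  | succ k ih => simp [altSeq, ih]

theorem mem_altSeq {a b x : α} {k : ℕ} (h : x ∈ altSeq a b k) : x = a ∨ x = b := by
  induction k generalizing a b with
  | zero => simp [altSeq] at h
  | succ k ih =>
    rcases List.mem_cons.1 h with h | h
    · exact Or.inl h
    · exact (ih h).symm

theorem altSeq_sublist_altSeq (a b : α) {j k : ℕ} (h : j ≤ k) :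
    (altSeq a b j).Sublist (altSeq a b k) := by
  induction j generalizing a b k with
  | zero => exact List.nil_sublist _
  | succ j ih =>
    obtain ⟨k, rfl⟩ : ∃ m, k = m + 1 := ⟨k - 1, by omega⟩
    exact (ih b a (by omega)).cons_cons a

/-- Both pieces of a splitting of an alternation are alternations. -/
theorem altSeq_eq_append {a b : α} {k : ℕ} {p q : List α} (h : altSeq a b k = p ++ q) :
    p = altSeq a b p.length ∧ (q = altSeq a b q.length ∨ q = altSeq b a q.length) ∧
      p.length + q.length = k := by
  induction p generalizing a b k with
  | nil =>
    simp only [List.nil_append] at h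
    subst h
    simp [altSeq]
  | cons x p ih =>
    cases k with
    | zero => simp [altSeq] at h
    | succ k =>
      simp only [altSeq, List.cons_append, List.cons.injEq] at h
      obtain ⟨rfl, h⟩ := h
      obtain ⟨h₁, h₂, h₃⟩ := ih h
      refine ⟨?_, h₂.symm, by simp; omega⟩
      rw [List.length_cons, altSeq, ← h₁]

theorem altSeq_succ' (a b : α) (k : ℕ) :
    altSeq a b (k + 1) = altSeq a b k ++ [if Even k then a else b] := by
  induction k generalizing a b with
  | zero => simp [altSeq]
  | succ k ih =>
    rw [altSeq, ih]
    by_cases hk : Even k <;> simp [altSeq, hk, Nat.even_add_one]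

theorem reverse_altSeq (a b : α) (k : ℕ) :
    (altSeq a b k).reverse = altSeq a b k ∨ (altSeq a b k).reverse = altSeq b a k := by
  have key : ∀ k : ℕ, (altSeq a b k).reverse =
      if Even k then altSeq b a k else altSeq a b k := by
    intro k
    induction k generalizing a b with
    | zero => simp [altSeq]
    | succ k ih =>
      by_cases hk : Even k
      · rw [altSeq, List.reverse_cons, ih, if_pos hk, if_neg (by simpa [Nat.even_add_one] using hk)]
        have h := altSeq_succ' a b k
        rw [if_pos hk] at h
        exact h.symm
      · rw [altSeq, List.reverse_cons, ih, if_neg hk, if_pos (by simpa [Nat.even_add_one] using hk)]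
        have h := altSeq_succ' b a k
        rw [if_neg hk] at h
        exact h.symm
  rw [key]
  split_ifs <;> simp

theorem AvoidsAlt.sublist {l m : List α} {k : ℕ} (h : AvoidsAlt l k) (hm : m.Sublist l) :
    AvoidsAlt m k :=
  fun a b hab hs => h a b hab (hs.trans hm)

theorem AvoidsAlt.lt {l : List α} {j k : ℕ} (h : AvoidsAlt l k) {a b : α} (hab : a ≠ b)
    (hs : (altSeq a b j).Sublist l) : j < k := by
  by_contra hjk
  exact h a b hab ((altSeq_sublist_altSeq a b (not_lt.1 hjk)).trans hs)

theorem AvoidsAlt.reverse {l : List α} {k : ℕ} (h : AvoidsAlt l k) : AvoidsAlt l.reverse k := by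
  intro a b hab hs
  have hs := hs.reverse
  rw [List.reverse_reverse] at hs
  rcases reverse_altSeq a b k with e | e <;> rw [e] at hs
  · exact h a b hab hs
  · exact h b a hab.symm hs

theorem AvoidsAlt.map {l : List α} {k : ℕ} (hk : 2 ≤ k) (h : AvoidsAlt l k) {f : α → β}
    (hf : Function.Injective f) : AvoidsAlt (l.map f) k := by
  intro a b hab hs
  have hmem := (altSeq_sublist_altSeq a b hk).trans hs |>.subset
  obtain ⟨x, -, rfl⟩ := List.mem_map.1 (hmem (by simp [altSeq] : a ∈ altSeq a b 2))
  obtain ⟨y, -, rfl⟩ := List.mem_map.1 (hmem (by simp [altSeq] : b ∈ altSeq (f x) b 2))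
  rw [← map_altSeq] at hs
  obtain ⟨m, hm, e⟩ := List.sublist_map_iff.1 hs
  exact h x y (fun e => hab (congrArg f e)) (List.map_injective_iff.2 hf e ▸ hm)

/-- If `b` occurs before `a` in `U`, an alternation starting with `a` extends to the left by `b`. -/
theorem cons_sublist_of_idxOf_le [DecidableEq α] {a b : α} (hab : a ≠ b) {t U V : List α}
    (h : (a :: t).Sublist U) (hle : (U ++ V).idxOf b ≤ (U ++ V).idxOf a) :
    (b :: a :: t).Sublist U := by
  induction U with
  | nil => simp at h
  | cons x U ih =>
    rw [List.cons_append] at hle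
    by_cases hxa : x = a
    · subst hxa
      rw [List.idxOf_cons_self, List.idxOf_cons_ne _ hab] at hle
      omega
    · have h' : (a :: t).Sublist U := by
        cases h with
        | cons _ h => exact h
        | cons_cons => exact absurd rfl hxa
      by_cases hxb : x = b
      · subst hxb
        exact h'.cons_cons x
      · rw [List.idxOf_cons_ne _ hxa, List.idxOf_cons_ne _ hxb] at hle
        exact (ih h' (by omega)).cons x

end Alternations

section Blocks

variable {α ι : Type*} {S : ι → ι → Prop} {tag : α → ι} {c : List ι} {f : ι → List α}

theorem pairwise_flatMap_tag (hc : c.Pairwise S) (hf : ∀ i, ∀ x ∈ f i, tag x = i) :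
    (c.flatMap f).Pairwise fun x y => tag x = tag y ∨ S (tag x) (tag y) := by
  rw [List.pairwise_flatMap]
  refine ⟨fun i _ => List.pairwise_of_forall_mem_list fun x hx y hy => ?_, hc.imp ?_⟩
  · exact Or.inl ((hf i x hx).trans (hf i y hy).symm)
  · intro i j hij x hx y hy
    rw [hf i x hx, hf j y hy]
    exact Or.inr hij

theorem sublist_block (hS : ∀ i, ¬ S i i) (hc : c.Pairwise S)
    (hf : ∀ i, ∀ x ∈ f i, tag x = i) {i : ι} {p : List α} (hp : ∀ x ∈ p, tag x = i)
    (h : p.Sublist (c.flatMap f)) : p.Sublist (f i) := by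
  induction c generalizing p with
  | nil => simp_all
  | cons j c ih =>
    rw [List.pairwise_cons] at hc
    rw [List.flatMap_cons, List.sublist_append_iff] at h
    obtain ⟨p₁, p₂, rfl, h₁, h₂⟩ := h
    by_cases hij : j = i
    · subst hij
      have : p₂ = [] := by
        refine List.eq_nil_iff_forall_not_mem.2 fun x hx => ?_
        obtain ⟨m, hm, hxm⟩ := List.mem_flatMap.1 (h₂.subset hx)
        have e := hp x (by simp [hx])
        rw [hf m x hxm] at e
        exact hS j (e ▸ hc.1 m hm)
      simpa [this] using h₁
    · have : p₁ = [] := by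
        refine List.eq_nil_iff_forall_not_mem.2 fun x hx => hij ?_
        rw [← hf j x (h₁.subset hx), hp x (by simp [hx])]
      subst this
      exact ih hc.2 (by simpa using hp) h₂

theorem lt_three_of_altSeq_sublist (hS : ∀ i j, S i j → ¬ S j i) (hc : c.Pairwise S)
    (hf : ∀ i, ∀ x ∈ f i, tag x = i) {a b : α} {k : ℕ} (hab : tag a ≠ tag b)
    (h : (altSeq a b k).Sublist (c.flatMap f)) : k < 3 := by
  by_contra hk
  have h3 := (altSeq_sublist_altSeq a b (not_lt.1 hk)).trans h
  have hp := (pairwise_flatMap_tag hc hf).sublist h3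
  simp only [altSeq, List.pairwise_cons, List.mem_cons] at hp
  have h1 := (hp.1 b (by simp)).resolve_left hab
  have h2 := (hp.2.1 a (by simp)).resolve_left hab.symm
  exact hS _ _ h1 h2

theorem avoidsAlt_flatMap (hS : ∀ i j, S i j → ¬ S j i) (hc : c.Pairwise S)
    (hf : ∀ i, ∀ x ∈ f i, tag x = i) {k : ℕ} (hk : 3 ≤ k) (hav : ∀ i, AvoidsAlt (f i) k) :
    AvoidsAlt (c.flatMap f) k := by
  intro a b hab h
  by_cases ht : tag a = tag b
  · refine hav (tag a) a b hab
      (sublist_block (fun i hi => hS i i hi hi) hc hf (fun x hx => ?_) h)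
    rcases mem_altSeq hx with rfl | rfl
    · rfl
    · exact ht.symm
  · exact absurd (lt_three_of_altSeq_sublist hS hc hf ht h) (by omega)

theorem isChain_flatMap_tag (hS : ∀ i, ¬ S i i) (hc : c.Pairwise S)
    (hf : ∀ i, ∀ x ∈ f i, tag x = i) (hch : ∀ i, (f i).IsChain (· ≠ ·)) :
    (c.flatMap f).IsChain (· ≠ ·) := by
  induction c with
  | nil => simp
  | cons j c ih =>
    rw [List.pairwise_cons] at hc
    rw [List.flatMap_cons, List.isChain_append]
    refine ⟨hch j, ih hc.2, fun x hx y hy hxy => ?_⟩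
    obtain ⟨m, hm, hym⟩ := List.mem_flatMap.1 (List.mem_of_mem_head? hy)
    have h1 := hf j x (List.mem_of_mem_getLast? hx)
    rw [hxy, hf m y hym] at h1
    exact hS j (h1 ▸ hc.1 m hm)

theorem length_flatMap_const {L : ℕ} (hf : ∀ i, (f i).length = L) :
    (c.flatMap f).length = c.length * L := by
  simp [List.length_flatMap, hf]

end Blocks

theorem exists_append_isChain {α : Type*} {l m : List α} (hl : l.IsChain (· ≠ ·))
    (hm : m.IsChain (· ≠ ·)) :
    ∃ w : List α, w.Sublist (l ++ m) ∧ w.IsChain (· ≠ ·) ∧ l.length + m.length ≤ w.length + 1 := by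
  cases m with
  | nil => exact ⟨l, by simp, hl, by simp⟩
  | cons y m =>
    by_cases hy : y ∈ l.getLast?
    · refine ⟨l ++ m, by simp, ?_, by simp; omega⟩
      rw [List.isChain_append]
      refine ⟨hl, hm.tail, fun x hx z hz => ?_⟩
      obtain rfl : y = x := Option.mem_unique hy hx
      rw [List.isChain_cons] at hm
      exact hm.1 z hz
    · refine ⟨l ++ y :: m, List.Sublist.refl _, ?_, by simp⟩
      rw [List.isChain_append]
      refine ⟨hl, hm, fun x hx z hz hxz => hy ?_⟩
      simp only [List.head?_cons, Option.mem_def, Option.some.injEq] at hz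
      rwa [hz, ← hxz]

theorem exists_pairwise_lt_of_injective {ι : Type*} [Fintype ι] {ρ : ι → ℕ}
    (hρ : Function.Injective ρ) :
    ∃ c : List ι, c.Pairwise (fun i j => ρ i < ρ j) ∧ c.length = Fintype.card ι := by
  let _ := LinearOrder.lift' ρ hρ
  refine ⟨(Finset.univ : Finset ι).sort (· ≤ ·), ?_, by rw [Finset.length_sort, Finset.card_univ]⟩
  exact (Finset.sortedLT_sort _).pairwise

/-- The squaring construction: read all rows, then all columns, of a square array of symbols. -/
theorem exists_square {α : Type} [Fintype α] {s : ℕ} (hs : 2 ≤ s) {U : List α}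
    (hU : U.IsChain (· ≠ ·)) (hav : AvoidsAlt U (s + 2)) :
    ∃ W : List (α × α), W.IsChain (· ≠ ·) ∧ AvoidsAlt W (s + 3) ∧
      2 * (Fintype.card α * U.length) ≤ W.length + 1 := by
  classical
  set V : List α := Finset.univ.toList with hV
  have inj : ∀ U : List α, Function.Injective fun i => (U ++ V).idxOf i := fun U i j hij =>
    (List.idxOf_inj (by simp [hV])).1 hij
  obtain ⟨r, hr, hrl⟩ := exists_pairwise_lt_of_injective (inj U)
  obtain ⟨c, hc, hcl⟩ := exists_pairwise_lt_of_injective (inj U.reverse)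
  have hr' := List.pairwise_reverse.2 hr
  set f : α → List (α × α) := fun i => U.map fun j => (i, j) with hf
  set g : α → List (α × α) := fun j => U.map fun i => (i, j) with hg
  have hft : ∀ i, ∀ x ∈ f i, x.1 = i := by simp +contextual [hf]
  have hgt : ∀ j, ∀ x ∈ g j, x.2 = j := by simp +contextual [hg]
  have hfi : ∀ i : α, Function.Injective fun j : α => (i, j) := fun i x y h => by simpa using h
  have hgi : ∀ j : α, Function.Injective fun i : α => (i, j) := fun i x y h => by simpa using h
  have hfav := avoidsAlt_flatMap (fun i j h => not_lt.2 h.le) hr' hft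
    (by omega : 3 ≤ s + 2) fun i => hav.map (by omega) (hfi i)
  have hgav := avoidsAlt_flatMap (fun i j h => not_lt.2 h.le) hc hgt
    (by omega : 3 ≤ s + 2) fun i => hav.map (by omega) (hgi i)
  have hfch := isChain_flatMap_tag (fun i h => h.ne rfl) hr' hft fun i =>
    (List.isChain_map _).2 (hU.imp fun x y h => (hfi i).ne h)
  have hgch := isChain_flatMap_tag (fun i h => h.ne rfl) hc hgt fun i =>
    (List.isChain_map _).2 (hU.imp fun x y h => (hgi i).ne h)
  obtain ⟨W, hWs, hWc, hWl⟩ := exists_append_isChain hfch hgch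
  refine ⟨W, hWc, AvoidsAlt.sublist ?_ hWs, ?_⟩
  swap
  · rw [length_flatMap_const (L := U.length) (by simp [hf]),
      length_flatMap_const (L := U.length) (by simp [hg]), List.length_reverse, hrl, hcl] at hWl
    omega
  intro a b hab h
  obtain ⟨p, q, hpq, hp, hq⟩ := List.sublist_append_iff.1 h
  obtain ⟨hpe, hqe, hlen⟩ := altSeq_eq_append hpq
  have hqlt : ∀ k, (a.2 ≠ b.2 → k = 3) → (a.2 = b.2 → k = s + 2) → q.length < k := by
    intro k h1 h2
    by_cases e : a.2 = b.2
    · rw [h2 e]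
      rcases hqe with e' | e' <;> rw [e'] at hq
      · exact hgav.lt hab hq
      · exact hgav.lt hab.symm hq
    · rw [h1 e]
      rcases hqe with e' | e' <;> rw [e'] at hq
      · exact lt_three_of_altSeq_sublist (fun i j h => not_lt.2 h.le) hc hgt e hq
      · exact lt_three_of_altSeq_sublist (fun i j h => not_lt.2 h.le) hc hgt (Ne.symm e) hq
  have hplt : p.length < s + 2 := by
    rw [hpe] at hp
    exact hfav.lt hab hp
  have hplt' : a.1 ≠ b.1 → p.length < 3 := fun e => by
    rw [hpe] at hp
    exact lt_three_of_altSeq_sublist (fun i j h => not_lt.2 h.le) hr' hft e hp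
  by_cases hcol : a.2 = b.2
  · have hrow : a.1 ≠ b.1 := fun e => hab (Prod.ext e hcol)
    have h1 := hplt' hrow
    have h2 := hqlt (s + 2) (absurd hcol) fun _ => rfl
    have hp2 : p.length = 2 := by omega
    rw [hp2] at hpe
    simp only [altSeq] at hpe
    subst hpe
    obtain rfl : altSeq a b (s + 1) = q := List.append_cancel_left (as := [a, b]) hpq
    have hlt := ((pairwise_flatMap_tag hr' hft).sublist hp)
    simp only [List.pairwise_cons, List.mem_singleton, forall_eq] at hlt
    have hlt := hlt.1.resolve_left hrow
    have hq' := (sublist_block (fun i h => h.ne rfl) hc hgt (i := a.2) (fun x hx => by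
      rcases mem_altSeq hx with rfl | rfl
      · rfl
      · exact hcol.symm) hq).map Prod.fst
    rw [map_altSeq] at hq'
    simp only [hg, List.map_map, Function.comp_def, List.map_id'] at hq'
    exact hav b.1 a.1 hrow.symm (cons_sublist_of_idxOf_le hrow hq' hlt.le)
  · have h2 := hqlt 3 (fun _ => rfl) fun e => absurd e hcol
    by_cases hrow : a.1 = b.1
    · have hq2 : q.length = 2 := by omega
      obtain ⟨x, y, rfl⟩ := List.length_eq_two.1 hq2
      have hrev := congrArg List.reverse hpq
      have hyx : (y = a ∧ x = b ∨ y = b ∧ x = a) ∧ p.reverse = altSeq y x (s + 1) := by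
        rcases reverse_altSeq a b (s + 3) with e | e <;> rw [e] at hrev <;>
          simp only [altSeq, List.reverse_append, List.reverse_cons, List.reverse_nil,
            List.nil_append, List.cons_append, List.cons.injEq] at hrev <;>
          obtain ⟨rfl, rfl, hrev⟩ := hrev <;> simp [← hrev, altSeq]
      obtain ⟨hyx, hpr⟩ := hyx
      have hcol' : y.2 ≠ x.2 := by
        rcases hyx with ⟨rfl, rfl⟩ | ⟨rfl, rfl⟩
        · exact hcol
        · exact Ne.symm hcol
      have hrow' : y.1 = x.1 := by
        rcases hyx with ⟨rfl, rfl⟩ | ⟨rfl, rfl⟩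
        · exact hrow
        · exact hrow.symm
      have hlt := ((pairwise_flatMap_tag hc hgt).sublist hq)
      simp only [List.pairwise_cons, List.mem_singleton, forall_eq] at hlt
      have hlt := hlt.1.resolve_left hcol'.symm
      have hp' := ((sublist_block (fun i h => h.ne rfl) hr' hft (i := y.1) (fun z hz => by
        rw [← List.mem_reverse, hpr] at hz
        rcases mem_altSeq hz with rfl | rfl
        · rfl
        · exact hrow'.symm) hp).map Prod.snd).reverse
      rw [← List.map_reverse, hpr, map_altSeq] at hp'
      simp only [hf, List.map_map, Function.comp_def, List.map_id'] at hp'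
      exact hav.reverse x.2 y.2 hcol'.symm (cons_sublist_of_idxOf_le hcol' hp' hlt.le)
    · have := hplt' hrow
      omega

theorem exists_tower (t : ℕ) :
    ∃ (α : Type) (_ : Fintype α) (U : List α), Fintype.card α = 2 ^ 2 ^ t ∧
      U.IsChain (· ≠ ·) ∧ AvoidsAlt U (t + 4) ∧ 2 ^ 2 ^ t * (2 ^ t + 2) ≤ 2 * U.length := by
  induction t with
  | zero =>
    refine ⟨Bool, inferInstance, [true, false, true], by simp, by simp, ?_, by simp⟩
    intro a b _ h
    simpa using h.length_le
  | succ t ih =>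
    obtain ⟨α, _, U, hcard, hch, hav, hlen⟩ := ih
    obtain ⟨W, hWc, hWa, hWl⟩ := exists_square (by omega : 2 ≤ t + 2) hch hav
    have hm : 2 ^ 2 ^ (t + 1) = 2 ^ 2 ^ t * 2 ^ 2 ^ t := by rw [pow_succ 2 t, pow_mul, sq]
    refine ⟨α × α, inferInstance, W, by rw [Fintype.card_prod, hcard, hm], hWc, hWa, ?_⟩
    rw [hcard] at hWl
    rw [hm, pow_succ 2 t]
    have hpos : 0 < 2 ^ 2 ^ t := by positivity
    generalize 2 ^ 2 ^ t = m at *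
    generalize 2 ^ t = d at *
    nlinarith [Nat.mul_le_mul_left m hlen, Nat.mul_pos hpos hpos]

section Bound

variable {α : Type*} [DecidableEq α]

/-- The length of the longest alternation starting with `a` in a list, computed greedily. -/
def greedyAlt (a b : α) : List α → ℕ
  | [] => 0
  | x :: l => if x = a then greedyAlt b a l + 1 else greedyAlt a b l

theorem altSeq_greedyAlt_sublist (a b : α) (l : List α) :
    (altSeq a b (greedyAlt a b l)).Sublist l := by
  induction l generalizing a b with
  | nil => simp [greedyAlt, altSeq]
  | cons x l ih =>
    rw [greedyAlt]
    split_ifs with h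
    · subst h
      exact (ih b x).cons_cons x
    · exact (ih a b).cons x

theorem greedyAlt_le_swap_add_one {a b : α} (hab : a ≠ b) (l : List α) :
    greedyAlt a b l ≤ greedyAlt b a l + 1 := by
  induction l with
  | nil => simp [greedyAlt]
  | cons x l ih =>
    simp only [greedyAlt]
    split_ifs with h1 h2
    · exact absurd (h1.symm.trans h2) hab
    · exact le_rfl
    · omega
    · exact ih

theorem greedyAlt_le_cons {a b : α} (hab : a ≠ b) (x : α) (l : List α) :
    greedyAlt a b l ≤ greedyAlt a b (x :: l) := by
  rw [greedyAlt]
  split_ifs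
  · exact greedyAlt_le_swap_add_one hab l
  · exact le_rfl

theorem length_le_sum_greedyAlt [Fintype α] {l : List α} (hl : l.IsChain (· ≠ ·)) :
    l.length ≤ ∑ p ∈ (Finset.univ : Finset α).offDiag, greedyAlt p.1 p.2 l + 1 := by
  induction l with
  | nil => simp
  | cons x l ih =>
    cases l with
    | nil => simp
    | cons y l =>
      have hxy : x ≠ y := by
        rw [List.isChain_cons_cons] at hl
        exact hl.1
      have hlt : ∑ p ∈ (Finset.univ : Finset α).offDiag, greedyAlt p.1 p.2 (y :: l) <
          ∑ p ∈ (Finset.univ : Finset α).offDiag, greedyAlt p.1 p.2 (x :: y :: l) := by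
        refine Finset.sum_lt_sum (fun p hp => ?_) ⟨(x, y), by simpa using hxy, ?_⟩
        · exact greedyAlt_le_cons (by simpa using hp) x _
        · simp [greedyAlt, hxy.symm]
      have := ih hl.tail
      simp only [List.length_cons] at this ⊢
      omega

end Bound

theorem IsDS.length_le_lambdaDS {s n : ℕ} {l : List (Fin n)} (h : IsDS s n l) :
    l.length ≤ lambdaDS s n := by
  refine le_csSup ⟨∑ p ∈ (Finset.univ : Finset (Fin n)).offDiag, (s + 2) + 1, ?_⟩ ⟨l, h, rfl⟩
  rintro _ ⟨m, hm, rfl⟩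
  refine (length_le_sum_greedyAlt hm.1).trans (Nat.add_le_add_right (Finset.sum_le_sum ?_) 1)
  intro p hp
  exact (hm.2.lt (by simpa using hp) (altSeq_greedyAlt_sublist p.1 p.2 m)).le

theorem le_lambdaDS_one (n : ℕ) : n ≤ lambdaDS 1 n := by
  have h : IsDS 1 n (List.finRange n) := by
    refine ⟨(List.nodup_finRange n).isChain, fun a b _ hs => ?_⟩
    have := hs.nodup (List.nodup_finRange n)
    simp [altSeq] at this
  simpa using h.length_le_lambdaDS

theorem le_lambdaDS_of_tower_le {t n : ℕ} (hn : 2 ^ 2 ^ t ≤ n) :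
    n * 2 ^ t ≤ 4 * lambdaDS (t + 2) n := by
  obtain ⟨α, _, U, hcard, hch, hav, hlen⟩ := exists_tower t
  have hpos : 0 < 2 ^ 2 ^ t := by positivity
  generalize 2 ^ 2 ^ t = m at *
  set k := n / m with hk
  have hkm : k * m ≤ n := Nat.div_mul_le_self n m
  have hk1 : 1 ≤ k := (Nat.one_le_div_iff hpos).2 hn
  have hn2 : n ≤ 2 * (k * m) := by
    have h1 : n < m * (k + 1) := Nat.lt_mul_div_succ n hpos
    nlinarith
  obtain ⟨φ⟩ : Nonempty (Fin k × α ↪ Fin n) :=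
    Function.Embedding.nonempty_of_card_le (by simpa [hcard] using hkm)
  have hinj : ∀ i : Fin k, Function.Injective fun j : α => (i, j) :=
    fun i x y h => by simpa using h
  have htag : ∀ i : Fin k, ∀ x ∈ U.map fun j : α => (i, j), x.1 = i := by simp +contextual
  have hc : (List.finRange k).Pairwise (· < ·) := List.pairwise_lt_finRange k
  have hds : IsDS (t + 2) n
      (((List.finRange k).flatMap fun i => U.map fun j : α => (i, j)).map φ) := by
    refine ⟨(List.isChain_map _).2 (List.IsChain.imp (fun x y h => φ.injective.ne h) ?_), ?_⟩
    · exact isChain_flatMap_tag (fun i h => h.ne rfl) hc htag fun i =>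
        (List.isChain_map _).2 (hch.imp fun x y h => (hinj i).ne h)
    · exact (avoidsAlt_flatMap (fun i j h => not_lt.2 h.le) hc htag (by omega)
        fun i => hav.map (by omega) (hinj i)).map (by omega) φ.injective
  have hle := hds.length_le_lambdaDS
  rw [List.length_map, length_flatMap_const (L := U.length) (by simp), List.length_finRange] at hle
  calc n * 2 ^ t ≤ 2 * (k * m) * 2 ^ t := Nat.mul_le_mul_right _ hn2
    _ ≤ 2 * k * (m * (2 ^ t + 2)) := by nlinarith [Nat.zero_le (k * m)]
    _ ≤ 2 * k * (2 * U.length) := Nat.mul_le_mul_left _ hlen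
    _ = 4 * (k * U.length) := by ring
    _ ≤ 4 * lambdaDS (t + 2) n := Nat.mul_le_mul_left _ hle

theorem tower_le_of_le_logb {t n : ℕ} (hn : 4 ≤ n)
    (h : (t : ℝ) ≤ Real.logb 2 (Real.logb 2 n)) : 2 ^ 2 ^ t ≤ n := by
  have hn' : (4 : ℝ) ≤ n := by exact_mod_cast hn
  have hlog : 0 < Real.logb 2 n := Real.logb_pos (by norm_num) (by linarith)
  rw [Real.le_logb_iff_rpow_le (by norm_num) hlog, Real.rpow_natCast,
    Real.le_logb_iff_rpow_le (by norm_num) (by linarith)] at h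
  have h' : (2 : ℝ) ^ (((2 ^ t : ℕ) : ℝ)) ≤ n := by exact_mod_cast h
  rw [Real.rpow_natCast] at h'
  exact_mod_cast h'

theorem stmt3 :
    ∃ c : ℝ, 0 < c ∧ ∀ n s : ℕ, 4 ≤ n → 1 ≤ s →
      (s : ℝ) ≤ Real.logb 2 (Real.logb 2 n) + 2 →
      c * n * 2 ^ s ≤ (lambdaDS s n : ℝ) := by
  refine ⟨1 / 16, by norm_num, fun n s hn hs hle => ?_⟩
  obtain rfl | ⟨t, rfl⟩ : s = 1 ∨ ∃ t, s = t + 2 := by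
    rcases hs.eq_or_lt with h | h
    · exact Or.inl h.symm
    · exact Or.inr ⟨s - 2, by omega⟩
  · have h : (n : ℝ) ≤ lambdaDS 1 n := by exact_mod_cast le_lambdaDS_one n
    have : (0 : ℝ) ≤ n := Nat.cast_nonneg n
    linarith
  · push_cast at hle
    have h : (n : ℝ) * 2 ^ t ≤ 4 * lambdaDS (t + 2) n := by
      exact_mod_cast le_lambdaDS_of_tower_le (tower_le_of_le_logb hn (by linarith))
    rw [pow_add]
    linarith
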